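/- Let b > 0, γ_a > 0, γ_e > 0 and (x_i, y_i, z_i) ∈ ℝ³ with x_i > 0, -γ_a ≤ y_i/x_i ≤ γ_a and -γ_e ≤ z_i/x_i ≤ γ_e. Then the point v* = (y_i/x_i, z_i/x_i) lies in V and the gradient of h_i vanishes at v*; consequently v* together with the zero multipliers μ₁ = μ₂ = μ₃ = μ₄ = 0 satisfies the KKT system for both the minimization and the maximization of h_i over V. -/

import Mathlib

/-- The function `h_i` of Lemma 1. -/
noncomputable def hfun (b xi yi zi : ℝ) (v : ℝ × ℝ) : ℝ :=
  -2 * b * (xi + yi * v.1 + zi * v.2) / Real.sqrt (1 + v.1 ^ 2 + v.2 ^ 2)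
    + (xi ^ 2 + yi ^ 2 + zi ^ 2) + b ^ 2

/-- The box `V = [-γ_a, γ_a] × [-γ_e, γ_e]`. -/
def Vbox (γa γe : ℝ) : Set (ℝ × ℝ) := Set.Icc (-γa) γa ×ˢ Set.Icc (-γe) γe

/-- One-variable computation: the partial functions of `h_i` are differentiable with
derivative `0` at `t` as soon as `q * c = p * t`. -/
theorem hasDerivAt_aux (b p q c t d e : ℝ) (hc : 0 < c) (h : q * c = p * t) :
    HasDerivAt (fun u : ℝ => -2 * b * (p + q * u) / Real.sqrt (c + u ^ 2) + d + e) 0 t := by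
  have hpos : 0 < c + t ^ 2 := by positivity
  have hs : 0 < Real.sqrt (c + t ^ 2) := Real.sqrt_pos.mpr hpos
  have hsq : Real.sqrt (c + t ^ 2) ^ 2 = c + t ^ 2 := Real.sq_sqrt hpos.le
  have h1 : HasDerivAt (fun u : ℝ => -2 * b * (p + q * u)) (-2 * b * (q * 1)) t :=
    (((hasDerivAt_id t).const_mul q).const_add p).const_mul (-2 * b)
  have h2 : HasDerivAt (fun u : ℝ => c + u ^ 2) (2 * t) t := by
    simpa using (hasDerivAt_pow 2 t).const_add c
  have h3 := ((h1.div (h2.sqrt hpos.ne') hs.ne').add_const d).add_const e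
  refine HasDerivAt.congr_deriv h3 ?_
  rw [div_eq_zero_iff]
  left
  field_simp
  rw [hsq]
  linear_combination (-2 * b) * h

/-- Case 1 of Theorem 1: the interior candidate `(y_i/x_i, z_i/x_i)` is
feasible and the gradient of `h_i` vanishes there, so with zero multipliers it
satisfies the KKT system of both the minimization and the maximization. -/
theorem stmt_15 (b γa γe xi yi zi : ℝ) (hb : 0 < b) (hγa : 0 < γa) (hγe : 0 < γe)
    (hxi : 0 < xi)
    (hy1 : -γa ≤ yi / xi) (hy2 : yi / xi ≤ γa)
    (hz1 : -γe ≤ zi / xi) (hz2 : zi / xi ≤ γe) :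
    ((yi / xi, zi / xi) : ℝ × ℝ) ∈ Vbox γa γe ∧
    deriv (fun u => hfun b xi yi zi (u, zi / xi)) (yi / xi) = 0 ∧
    deriv (fun u => hfun b xi yi zi (yi / xi, u)) (zi / xi) = 0 := by
  have hx : xi ≠ 0 := hxi.ne'
  refine ⟨⟨⟨hy1, hy2⟩, ⟨hz1, hz2⟩⟩, ?_, ?_⟩
  · have key := hasDerivAt_aux b (xi + zi * (zi / xi)) yi (1 + (zi / xi) ^ 2) (yi / xi)
      (xi ^ 2 + yi ^ 2 + zi ^ 2) (b ^ 2) (by positivity) (by field_simp)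
    refine Eq.trans (congrArg (fun f => deriv f (yi / xi)) ?_) key.deriv
    funext u
    simp only [hfun]
    rw [add_right_comm xi, add_right_comm 1]
  · have key := hasDerivAt_aux b (xi + yi * (yi / xi)) zi (1 + (yi / xi) ^ 2) (zi / xi)
      (xi ^ 2 + yi ^ 2 + zi ^ 2) (b ^ 2) (by positivity) (by field_simp)
    exact key.deriv
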